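/- arXiv:1507.05843 — 2 statements merged into one kernel-verified Lean document; each statement's English description precedes it below -/
import Mathlib

section
/- Let φ be an N-function with the good φ' property with constant G, let φ̄ be its square-root function, given by φ̄(t) = ∫₀ᵗ √(s·φ'(s)) ds, and define V on real symmetric d×d matrices by V(Q) = φ̄'(|Q|)·Q/|Q| = √(φ'(|Q|)/|Q|)·Q for Q ≠ 0 and V(0) = 0. Then there exist constants c, C > 0 depending only on G such that for all symmetric d×d matrices P, Q with |P| + |Q| > 0: (V(P) − V(Q)):(P − Q) ≥ c·φ̄''(|P| + |Q|)·|P − Q|² and |V(P) − V(Q)| ≤ C·φ̄''(|P| + |Q|)·|P − Q| (Corollary 2). -/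
open MeasureTheory Real Set Filter

noncomputable section

/-- `φ` is an N-function with right-continuous, non-decreasing density `φ'`:
`φ t = ∫₀ᵗ φ'`, `φ'(0) = 0`, `φ' > 0` on `(0,∞)`, `φ'(t) → ∞` as `t → ∞`. -/
def IsNFunction (φ φ' : ℝ → ℝ) : Prop :=
  (∀ t, 0 ≤ t → φ t = ∫ s in (0:ℝ)..t, φ' s) ∧
  (∀ s, 0 ≤ s → 0 ≤ φ' s) ∧
  (∀ s t, 0 ≤ s → s ≤ t → φ' s ≤ φ' t) ∧
  φ' 0 = 0 ∧
  (∀ t, 0 < t → 0 < φ' t) ∧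
  Filter.Tendsto φ' Filter.atTop Filter.atTop ∧
  (∀ t, 0 ≤ t → ContinuousWithinAt φ' (Set.Ici t) t)

/-- The Δ₂ condition with constant `K`: `φ(2t) ≤ K·φ(t)` for all `t ≥ 0`. -/
def Delta2 (φ : ℝ → ℝ) (K : ℝ) : Prop := ∀ t, 0 ≤ t → φ (2 * t) ≤ K * φ t

/-- The complementary (conjugate) function `φ*(t) = sup_{s ≥ 0} (t·s − φ(s))`. -/
def conjFn (φ : ℝ → ℝ) (t : ℝ) : ℝ := sSup {x | ∃ s, 0 ≤ s ∧ x = t * s - φ s}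

/-- The good `φ'` property with constant `G ≥ 1`:
`φ` is `C¹` on `[0,∞)` and `C²` on `(0,∞)` with
`G⁻¹·φ'(t) ≤ t·φ''(t) ≤ G·φ'(t)` for `t > 0`. -/
def GoodPhi (φ φ' φ'' : ℝ → ℝ) (G : ℝ) : Prop :=
  1 ≤ G ∧
  (∀ t, 0 < t → HasDerivAt φ (φ' t) t) ∧
  (∀ t, 0 < t → HasDerivAt φ' (φ'' t) t) ∧
  ContinuousWithinAt φ' (Set.Ici 0) 0 ∧
  (∀ t, 0 < t → ContinuousAt φ'' t) ∧
  (∀ t, 0 < t → G⁻¹ * φ' t ≤ t * φ'' t ∧ t * φ'' t ≤ G * φ' t)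

/-- The square-root N-function `φ̄(t) = ∫₀ᵗ √(s·φ'(s)) ds`. -/
def barPhi (φ' : ℝ → ℝ) (t : ℝ) : ℝ := ∫ s in (0:ℝ)..t, Real.sqrt (s * φ' s)

/-- Derivative of the square-root N-function: `φ̄'(t) = √(t·φ'(t))`. -/
def barPhi' (φ' : ℝ → ℝ) (t : ℝ) : ℝ := Real.sqrt (t * φ' t)

/-- Frobenius inner product `P : Q = ∑ᵢⱼ Pᵢⱼ·Qᵢⱼ`. -/
def minner {d : ℕ} (P Q : Matrix (Fin d) (Fin d) ℝ) : ℝ := ∑ i, ∑ j, P i j * Q i j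

/-- Frobenius norm `|P| = √(P : P)`. -/
def fnorm {d : ℕ} (P : Matrix (Fin d) (Fin d) ℝ) : ℝ := Real.sqrt (minner P P)

/-- The tensor `Q ↦ g(|Q|)·Q/|Q|` (with value `0` at `Q = 0`). -/
def tensorT {d : ℕ} (g : ℝ → ℝ) (Q : Matrix (Fin d) (Fin d) ℝ) :
    Matrix (Fin d) (Fin d) ℝ :=
  if Q = 0 then 0 else (g (fnorm Q) / fnorm Q) • Q

theorem aux_core {E : Type*} [NormedAddCommGroup E] [InnerProductSpace ℝ E] (p q : E)
    (α β G : ℝ) (hG : 1 ≤ G) (hα : 0 ≤ α) (hβ : 0 ≤ β) (hqp : ‖q‖ ≤ ‖p‖)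
    (h1 : β * ‖q‖ ≤ α * (‖p‖ + ‖q‖) / 2)
    (h2 : α * ‖q‖ - (G - 1) * α * (‖p‖ - ‖q‖) ≤ β * ‖q‖) :
    α / 2 * ‖p - q‖ ^ 2 ≤ inner ℝ (α • p - β • q) (p - q) ∧
    ‖α • p - β • q‖ ≤ (1 + G) * α * ‖p - q‖ := by
  have hcs := real_inner_le_norm p q
  have hab : 0 ≤ ‖p‖ - ‖q‖ := by linarith
  have htri : ‖p‖ - ‖q‖ ≤ ‖p - q‖ := norm_sub_norm_le p q
  constructor
  · rw [@norm_sub_sq_real]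
    simp only [inner_sub_left, inner_sub_right, real_inner_smul_left,
      real_inner_self_eq_norm_sq, real_inner_comm p q]
    nlinarith [mul_nonneg hβ (sub_nonneg.2 hcs), mul_le_mul_of_nonneg_right h1 hab]
  · have e : α • p - β • q = α • (p - q) + (α - β) • q := by
      simp only [smul_sub, sub_smul]; abel
    rw [e]
    refine (norm_add_le _ _).trans ?_
    rw [norm_smul, norm_smul, Real.norm_of_nonneg hα, Real.norm_eq_abs]
    have h3 : |α - β| * ‖q‖ ≤ G * α * (‖p‖ - ‖q‖) := by
      rw [← abs_of_nonneg (norm_nonneg q), ← abs_mul, abs_of_nonneg (norm_nonneg q), abs_le]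
      have h4 := mul_nonneg hα hab
      constructor <;> nlinarith [mul_nonneg (sub_nonneg.2 hG) h4]
    have h5 : G * α * (‖p‖ - ‖q‖) ≤ G * α * ‖p - q‖ :=
      mul_le_mul_of_nonneg_left htri (by positivity)
    linarith

/-- Flattening of a matrix to a Euclidean vector. -/
def auxVec {d : ℕ} (P : Matrix (Fin d) (Fin d) ℝ) : EuclideanSpace ℝ (Fin d × Fin d) :=
  WithLp.toLp 2 (fun ij => P ij.1 ij.2)

theorem auxVec_inner {d : ℕ} (P Q : Matrix (Fin d) (Fin d) ℝ) :
    minner P Q = inner ℝ (auxVec P) (auxVec Q) := by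
  simp only [minner, auxVec, PiLp.inner_apply, Fintype.sum_prod_type]
  simp [mul_comm]

theorem auxVec_norm {d : ℕ} (P : Matrix (Fin d) (Fin d) ℝ) : fnorm P = ‖auxVec P‖ := by
  rw [fnorm, auxVec_inner, real_inner_self_eq_norm_sq, Real.sqrt_sq (norm_nonneg _)]

theorem auxVec_sub {d : ℕ} (P Q : Matrix (Fin d) (Fin d) ℝ) :
    auxVec (P - Q) = auxVec P - auxVec Q := by
  ext; simp [auxVec]

theorem auxVec_smul {d : ℕ} (r : ℝ) (P : Matrix (Fin d) (Fin d) ℝ) :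
    auxVec (r • P) = r • auxVec P := by
  ext; simp [auxVec]

theorem aux_tensor {d : ℕ} (g : ℝ → ℝ) (Q : Matrix (Fin d) (Fin d) ℝ) :
    tensorT g Q = (g (fnorm Q) / fnorm Q) • Q := by
  unfold tensorT
  split_ifs with h
  · simp [h]
  · rfl

theorem aux_anti {φ φ' φ'' : ℝ → ℝ} {G : ℝ} (hg : GoodPhi φ φ' φ'' G) :
    AntitoneOn (fun t => φ' t * t ^ (-G)) (Ioi 0) := by
  obtain ⟨hG, -, hd, -, -, hb⟩ := hg
  have hD : ∀ t : ℝ, 0 < t → HasDerivAt (fun t => φ' t * t ^ (-G))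
      (φ'' t * t ^ (-G) + φ' t * (-G * t ^ (-G - 1))) t := fun t ht =>
    (hd t ht).mul (Real.hasDerivAt_rpow_const (Or.inl ht.ne'))
  apply antitoneOn_of_deriv_nonpos (convex_Ioi 0)
  · exact fun t ht => (hD t ht).continuousAt.continuousWithinAt
  · rw [interior_Ioi]
    exact fun t ht => (hD t ht).differentiableAt.differentiableWithinAt
  · rw [interior_Ioi]
    intro t ht
    have ht' : 0 < t := ht
    rw [(hD t ht).deriv]
    have e : t ^ (-G) = t ^ (-G - 1) * t := by
      rw [← Real.rpow_add_one ht'.ne']; ring_nf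
    rw [e]
    have := (hb t ht').2
    nlinarith [Real.rpow_pos_of_pos ht' (-G - 1)]

/-- Doubling-type bound for the square root function. -/
theorem aux_low {φ φ' φ'' : ℝ → ℝ} {G : ℝ} (hn : IsNFunction φ φ') (hg : GoodPhi φ φ' φ'' G)
    {b a : ℝ} (hb : 0 < b) (hba : b ≤ a) :
    (b / a) ^ G * barPhi' φ' a ≤ barPhi' φ' b := by
  have ha : 0 < a := hb.trans_le hba
  have h := aux_anti hg hb ha hba
  have hG := hg.1
  have hpa := hn.2.2.2.2.1 a ha
  have hpb := hn.2.2.2.2.1 b hb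
  have hx : 0 < b / a := by positivity
  have hx1 : b / a ≤ 1 := (div_le_one ha).2 hba
  have h1 : (b / a) ^ G * φ' a ≤ φ' b := by
    rw [Real.div_rpow hb.le ha.le]
    simp only [Real.rpow_neg ha.le, Real.rpow_neg hb.le, ← div_eq_mul_inv] at h
    have hA := Real.rpow_pos_of_pos ha G
    have hB := Real.rpow_pos_of_pos hb G
    rw [div_le_div_iff₀ hA hB] at h
    rw [div_mul_eq_mul_div, div_le_iff₀ hA]
    linarith
  have hX : 0 < (b / a) ^ G := Real.rpow_pos_of_pos hx G
  have h2 : (b / a) ^ G ≤ b / a := by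
    simpa using Real.rpow_le_rpow_of_exponent_ge hx hx1 hG
  unfold barPhi'
  apply Real.le_sqrt_of_sq_le
  rw [mul_pow, Real.sq_sqrt (by positivity)]
  calc ((b / a) ^ G) ^ 2 * (a * φ' a) = ((b / a) ^ G * a) * ((b / a) ^ G * φ' a) := by ring
    _ ≤ ((b / a) * a) * φ' b := by gcongr
    _ = b * φ' b := by field_simp

theorem aux_up {φ φ' : ℝ → ℝ} (hn : IsNFunction φ φ') {b a : ℝ} (hb : 0 ≤ b) (hba : b ≤ a)
    (ha : 0 < a) :
    barPhi' φ' b ≤ barPhi' φ' a / a * (a + b) / 2 := by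
  have hpa := hn.2.2.2.2.1 a ha
  have hm := hn.2.2.1 b a hb hba
  have hga : barPhi' φ' a ^ 2 = a * φ' a := by
    unfold barPhi'; rw [Real.sq_sqrt (by positivity)]
  have hg0 : 0 ≤ barPhi' φ' a := Real.sqrt_nonneg _
  rw [barPhi']
  apply Real.sqrt_le_iff.2 ⟨by positivity, ?_⟩
  have e : (barPhi' φ' a / a * (a + b) / 2) ^ 2 = φ' a / a * ((a + b) ^ 2 / 4) := by
    have : (barPhi' φ' a / a * (a + b) / 2) ^ 2
      = barPhi' φ' a ^ 2 / a ^ 2 * ((a + b) ^ 2 / 4) := by ring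
    rw [this, hga]; field_simp
  rw [e]
  calc b * φ' b ≤ b * φ' a := by gcongr
    _ = φ' a / a * (a * b) := by field_simp
    _ ≤ _ := by
      gcongr
      nlinarith [sq_nonneg (a - b)]

theorem aux_bern {φ φ' φ'' : ℝ → ℝ} {G : ℝ} (hn : IsNFunction φ φ') (hg : GoodPhi φ φ' φ'' G)
    {b a : ℝ} (hb : 0 ≤ b) (hba : b ≤ a) (ha : 0 < a) :
    barPhi' φ' a / a * b - (G - 1) * (barPhi' φ' a / a) * (a - b) ≤ barPhi' φ' b := by
  have hG := hg.1
  have hga : 0 ≤ barPhi' φ' a := Real.sqrt_nonneg _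
  have e : barPhi' φ' a / a * b - (G - 1) * (barPhi' φ' a / a) * (a - b)
      = (1 + G * (b / a - 1)) * barPhi' φ' a := by field_simp; ring
  rw [e]
  rcases hb.eq_or_lt with rfl | hb'
  · have : 0 ≤ barPhi' φ' 0 := Real.sqrt_nonneg _
    simp only [zero_div]
    nlinarith
  · refine le_trans ?_ (aux_low hn hg hb' hba)
    gcongr
    have hx : 0 < b / a := by positivity
    have := one_add_mul_self_le_rpow_one_add (s := b / a - 1) (by linarith) hG
    simpa using this

/-- Second derivative of the square root function. -/
def auxPsi (φ' φ'' : ℝ → ℝ) (t : ℝ) : ℝ := (φ' t + t * φ'' t) / (2 * barPhi' φ' t)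

theorem aux_deriv {φ φ' φ'' : ℝ → ℝ} {G : ℝ} (hn : IsNFunction φ φ') (hg : GoodPhi φ φ' φ'' G)
    {t : ℝ} (ht : 0 < t) : HasDerivAt (barPhi' φ') (auxPsi φ' φ'' t) t := by
  have hp := hn.2.2.2.2.1 t ht
  have h := ((hasDerivAt_id t).mul (hg.2.2.1 t ht)).sqrt (by simp; exact ⟨ht.ne', hp.ne'⟩)
  have e : auxPsi φ' φ'' t = (1 * φ' t + id t * φ'' t) / (2 * √(((id : ℝ → ℝ) * φ') t)) := by
    simp [auxPsi, barPhi']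
  rw [e]
  exact h

theorem aux_psi {φ φ' φ'' : ℝ → ℝ} {G : ℝ} (hn : IsNFunction φ φ') (hg : GoodPhi φ φ' φ'' G)
    {t : ℝ} (ht : 0 < t) : barPhi' φ' t / t / 2 ≤ auxPsi φ' φ'' t ∧
      auxPsi φ' φ'' t ≤ G * (barPhi' φ' t / t) := by
  have hG := hg.1
  have hp := hn.2.2.2.2.1 t ht
  obtain ⟨h1, h2⟩ := hg.2.2.2.2.2 t ht
  have h0 : 0 ≤ t * φ'' t := le_trans (by positivity) h1
  have hga : barPhi' φ' t ^ 2 = t * φ' t := by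
    unfold barPhi'; rw [Real.sq_sqrt (by positivity)]
  have hg0 : 0 < barPhi' φ' t := Real.sqrt_pos.2 (by positivity)
  have e : barPhi' φ' t / t = 2 * φ' t / (2 * barPhi' φ' t) := by
    rw [div_eq_div_iff ht.ne' (by positivity)]; nlinarith
  rw [e, auxPsi]
  constructor
  · rw [div_right_comm]; gcongr; linarith
  · rw [mul_div_assoc']; gcongr; nlinarith

theorem aux_main {φ φ' φ'' : ℝ → ℝ} {G : ℝ} (hn : IsNFunction φ φ') (hg : GoodPhi φ φ' φ'' G)
    {d : ℕ} (P Q : Matrix (Fin d) (Fin d) ℝ) (hPQ : fnorm Q ≤ fnorm P)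
    (hs : 0 < fnorm P + fnorm Q) :
    1 / (2 * (G * 2 ^ G)) * auxPsi φ' φ'' (fnorm P + fnorm Q) * fnorm (P - Q) ^ 2 ≤
      minner (tensorT (barPhi' φ') P - tensorT (barPhi' φ') Q) (P - Q) ∧
    fnorm (tensorT (barPhi' φ') P - tensorT (barPhi' φ') Q) ≤
      (4 * (1 + G)) * auxPsi φ' φ'' (fnorm P + fnorm Q) * fnorm (P - Q) := by
  have hG := hg.1
  have hb : 0 ≤ fnorm Q := Real.sqrt_nonneg _
  have hD : 0 ≤ fnorm (P - Q) := Real.sqrt_nonneg _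
  have ha : 0 < fnorm P := by linarith
  obtain ⟨p1, p2⟩ := aux_psi hn hg hs
  have hu := aux_up hn hb hPQ ha
  have hl := aux_bern hn hg hb hPQ ha
  have hlow := aux_low hn hg ha (show fnorm P ≤ fnorm P + fnorm Q by linarith)
  have hga : 0 ≤ barPhi' φ' (fnorm P) := Real.sqrt_nonneg _
  have hgb : 0 ≤ barPhi' φ' (fnorm Q) := Real.sqrt_nonneg _
  have hgs : 0 ≤ barPhi' φ' (fnorm P + fnorm Q) := Real.sqrt_nonneg _
  have hmono : barPhi' φ' (fnorm P) ≤ barPhi' φ' (fnorm P + fnorm Q) := by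
    apply Real.sqrt_le_sqrt
    have := hn.2.2.1 _ (fnorm P + fnorm Q) ha.le (by linarith)
    have := hn.2.1 _ ha.le
    gcongr
    linarith
  have hβ : barPhi' φ' (fnorm Q) / fnorm Q * fnorm Q = barPhi' φ' (fnorm Q) := by
    rcases hb.eq_or_lt with h | h
    · rw [← h]; simp [barPhi']
    · field_simp
  have h2G : (0:ℝ) < 2 ^ G := Real.rpow_pos_of_pos two_pos G
  -- comparison of the weights
  have w1 : barPhi' φ' (fnorm P) / fnorm P ≤ 4 * auxPsi φ' φ'' (fnorm P + fnorm Q) := by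
    have : barPhi' φ' (fnorm P) / fnorm P
        ≤ 2 * (barPhi' φ' (fnorm P + fnorm Q) / (fnorm P + fnorm Q)) := by
      rw [mul_div_assoc', div_le_div_iff₀ ha hs]
      nlinarith [mul_le_mul hmono (show fnorm P + fnorm Q ≤ 2 * fnorm P by linarith) hs.le hgs]
    linarith
  have w2 : auxPsi φ' φ'' (fnorm P + fnorm Q)
      ≤ G * 2 ^ G * (barPhi' φ' (fnorm P) / fnorm P) := by
    refine p2.trans ?_
    rw [mul_assoc]
    gcongr
    have h3 : (1 / 2 : ℝ) ^ G ≤ (fnorm P / (fnorm P + fnorm Q)) ^ G := by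
      apply Real.rpow_le_rpow (by norm_num) _ (by linarith)
      rw [div_le_div_iff₀ two_pos hs]; linarith
    rw [Real.div_rpow zero_le_one two_pos.le, Real.one_rpow] at h3
    have h4 : barPhi' φ' (fnorm P + fnorm Q) ≤ 2 ^ G * barPhi' φ' (fnorm P) := by
      have := (mul_le_mul_of_nonneg_right h3 hgs).trans hlow
      rwa [div_mul_eq_mul_div, one_mul, div_le_iff₀' h2G] at this
    rw [mul_div_assoc']
    apply div_le_div₀ (by positivity) h4 ha (by linarith)
  have key := aux_core (auxVec P) (auxVec Q) (barPhi' φ' (fnorm P) / fnorm P)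
    (barPhi' φ' (fnorm Q) / fnorm Q) G hG (by positivity) (by positivity)
    (by simpa only [← auxVec_norm] using hPQ)
    (by rw [← auxVec_norm, ← auxVec_norm, hβ]; exact hu)
    (by rw [← auxVec_norm, ← auxVec_norm, hβ]; exact hl)
  simp only [← auxVec_smul, ← auxVec_sub, ← auxVec_norm, ← auxVec_inner, ← aux_tensor] at key
  refine ⟨le_trans ?_ key.1, key.2.trans ?_⟩
  · gcongr
    rw [one_div_mul_eq_div, div_le_iff₀ (by positivity)]
    linarith
  · refine mul_le_mul_of_nonneg_right ?_ hD
    nlinarith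

/-- Corollary 2: monotonicity and growth for the square-root tensor
`V(Q) = φ̄'(|Q|)·Q/|Q|`, in terms of `φ̄''`. -/
theorem sqrt_tensor_monotonicity_growth :
    ∃ c C : ℝ → ℝ, ∀ (G : ℝ) (d : ℕ) (φ φ' φ'' : ℝ → ℝ),
      IsNFunction φ φ' → GoodPhi φ φ' φ'' G → 1 ≤ d →
      0 < c G ∧ 0 < C G ∧
      ∃ ψ'' : ℝ → ℝ,
        (∀ t, 0 < t → HasDerivAt (barPhi' φ') (ψ'' t) t) ∧
        ∀ P Q : Matrix (Fin d) (Fin d) ℝ, P.IsSymm → Q.IsSymm →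
          0 < fnorm P + fnorm Q →
          c G * ψ'' (fnorm P + fnorm Q) * fnorm (P - Q) ^ 2 ≤
            minner (tensorT (barPhi' φ') P - tensorT (barPhi' φ') Q) (P - Q) ∧
          fnorm (tensorT (barPhi' φ') P - tensorT (barPhi' φ') Q) ≤
            C G * ψ'' (fnorm P + fnorm Q) * fnorm (P - Q) := by
  refine ⟨fun G => 1 / (2 * (G * 2 ^ G)), fun G => 4 * (1 + G), ?_⟩
  intro G d φ φ' φ'' hn hg _
  have hG := hg.1
  have h2G : (0:ℝ) < 2 ^ G := Real.rpow_pos_of_pos two_pos G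
  refine ⟨by positivity, by positivity, auxPsi φ' φ'', fun t ht => aux_deriv hn hg ht, ?_⟩
  intro P Q _ _ hs
  rcases le_total (fnorm Q) (fnorm P) with h | h
  · exact aux_main hn hg P Q h hs
  · have key := aux_main hn hg Q P h (by linarith)
    have e1 : ∀ A B : Matrix (Fin d) (Fin d) ℝ, fnorm (A - B) = fnorm (B - A) := fun A B => by
      rw [auxVec_norm, auxVec_norm, auxVec_sub, auxVec_sub, norm_sub_rev]
    have e2 : ∀ A B C D : Matrix (Fin d) (Fin d) ℝ,
        minner (A - B) (C - D) = minner (B - A) (D - C) := fun A B C D => by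
      simp only [auxVec_inner, auxVec_sub]
      rw [← neg_sub (auxVec B), ← neg_sub (auxVec D), inner_neg_neg]
    rw [add_comm (fnorm P), e1 P Q, e2, e1 (tensorT _ P)]
    exact key
end
end

section
/- Let φ be an N-function with the good φ' property with constant G. Then there exist constants c, C > 0 depending only on G such that for all real symmetric d×d matrices S, T with |S| + |T| > 0: c·φ''(|S|+|T|)·|S−T| ≤ φ'_{|S|}(|S−T|) ≤ C·φ''(|S|+|T|)·|S−T| and c·φ''(|S|+|T|)·|S−T|² ≤ φ_{|S|}(|S−T|) ≤ C·φ''(|S|+|T|)·|S−T|² (equivalences (53) of Lemma 6). -/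
open MeasureTheory Real Set Filter

noncomputable section

/-- Shifted N-function `φ_a(t) = ∫₀ᵗ φ'(a+s)·s/(a+s) ds`. -/
def shPhi (φ' : ℝ → ℝ) (a t : ℝ) : ℝ := ∫ s in (0:ℝ)..t, φ' (a + s) * s / (a + s)

/-- Derivative of the shifted N-function: `φ'_a(t) = φ'(a+t)·t/(a+t)`. -/
def shPhi' (φ' : ℝ → ℝ) (a t : ℝ) : ℝ := φ' (a + t) * t / (a + t)

lemma fnorm_eq_norm_aux {d : ℕ} (P : Matrix (Fin d) (Fin d) ℝ) :
    fnorm P = ‖(WithLp.toLp 2 (fun x : Fin d × Fin d => P x.1 x.2) :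
      EuclideanSpace ℝ (Fin d × Fin d))‖ := by
  rw [EuclideanSpace.norm_eq, fnorm, minner, Fintype.sum_prod_type]
  congr 1
  refine Finset.sum_congr rfl fun i _ => Finset.sum_congr rfl fun j _ => ?_
  simp [sq]

lemma fnorm_tri_aux {d : ℕ} (S T : Matrix (Fin d) (Fin d) ℝ) :
    fnorm (S - T) ≤ fnorm S + fnorm T ∧ fnorm T ≤ fnorm S + fnorm (S - T) := by
  have h : (WithLp.toLp 2 (fun x : Fin d × Fin d => (S - T) x.1 x.2) :
      EuclideanSpace ℝ (Fin d × Fin d)) =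
      WithLp.toLp 2 (fun x : Fin d × Fin d => S x.1 x.2) -
      WithLp.toLp 2 (fun x : Fin d × Fin d => T x.1 x.2) := by
    ext x; simp
  rw [fnorm_eq_norm_aux, fnorm_eq_norm_aux, fnorm_eq_norm_aux, h]
  refine ⟨norm_sub_le _ _, ?_⟩
  exact norm_le_norm_add_norm_sub _ _

lemma fnorm_nonneg_aux {d : ℕ} (P : Matrix (Fin d) (Fin d) ℝ) : 0 ≤ fnorm P :=
  Real.sqrt_nonneg _

/-- Doubling of the derivative. -/
lemma doubling_aux {φ φ' φ'' : ℝ → ℝ} {G : ℝ} (hG : GoodPhi φ φ' φ'' G) {t : ℝ} (ht : 0 < t) :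
    φ' (2 * t) ≤ (2:ℝ) ^ G * φ' t := by
  obtain ⟨h1, -, hd, -, -, hb⟩ := hG
  have hder : ∀ x : ℝ, 0 < x → HasDerivAt (fun x => φ' x * x ^ (-G))
      (φ'' x * x ^ (-G) + φ' x * (-G * x ^ (-G - 1))) x := fun x hx =>
    (hd x hx).mul (Real.hasDerivAt_rpow_const (Or.inl hx.ne'))
  have hanti : AntitoneOn (fun x => φ' x * x ^ (-G)) (Ioi 0) := by
    refine antitoneOn_of_hasDerivWithinAt_nonpos (convex_Ioi 0)
      (fun x hx => (hder x hx).continuousAt.continuousWithinAt)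
      (f' := fun x => φ'' x * x ^ (-G) + φ' x * (-G * x ^ (-G - 1))) ?_ ?_
    · intro x hx
      rw [interior_Ioi] at hx
      exact (hder x hx).hasDerivWithinAt
    · intro x hx
      rw [interior_Ioi] at hx
      have hx' : 0 < x := hx
      have e : x ^ (-G) = x ^ (-G - 1) * x := by
        rw [Real.rpow_sub_one hx'.ne']; field_simp
      have hp : 0 < x ^ (-G - 1) := Real.rpow_pos_of_pos hx' _
      have := (hb x hx').2
      show φ'' x * x ^ (-G) + φ' x * (-G * x ^ (-G - 1)) ≤ 0
      rw [e]
      nlinarith [mul_le_mul_of_nonneg_left this hp.le]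
  have h := hanti (a := t) (b := 2 * t) ht (by simp [ht]) (by linarith)
  simp only at h
  rw [Real.mul_rpow (by norm_num) ht.le, Real.rpow_neg (by norm_num : (0:ℝ) ≤ 2)] at h
  have hp : 0 < t ^ (-G) := Real.rpow_pos_of_pos ht _
  have h2 : (0:ℝ) < 2 ^ G := Real.rpow_pos_of_pos (by norm_num) _
  have h3 : (φ' (2 * t) * ((2:ℝ) ^ G)⁻¹) * t ^ (-G) ≤ φ' t * t ^ (-G) := by linarith
  have h4 := le_of_mul_le_mul_right h3 hp
  rw [← div_eq_mul_inv, div_le_iff₀ h2] at h4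
  linarith

lemma shPhi'_mono_aux {φ φ' : ℝ → ℝ} (hN : IsNFunction φ φ') {a : ℝ} (ha : 0 ≤ a) :
    MonotoneOn (shPhi' φ' a) (Ici 0) := by
  obtain ⟨-, hnn, hm, -, -, -, -⟩ := hN
  intro x hx y hy hxy
  have hx : 0 ≤ x := hx
  have hy : 0 ≤ y := hy
  unfold shPhi'
  rcases hx.eq_or_lt with rfl | hx0
  · have := hnn (a + y) (by positivity)
    simp only [mul_zero, zero_div]
    positivity
  · have h1 := hnn (a + x) (by positivity)
    have h2 := hm (a + x) (a + y) (by positivity) (by linarith)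
    have h3 : x / (a + x) ≤ y / (a + y) := by
      rw [div_le_div_iff₀ (by linarith) (by linarith)]
      nlinarith
    rw [mul_div_assoc, mul_div_assoc]
    exact mul_le_mul h2 h3 (by positivity) (h1.trans h2)

lemma shPhi_bounds_aux {φ φ' : ℝ → ℝ} (hN : IsNFunction φ φ') {a t : ℝ} (ha : 0 ≤ a)
    (ht : 0 ≤ t) :
    t / 2 * shPhi' φ' a (t / 2) ≤ shPhi φ' a t ∧ shPhi φ' a t ≤ t * shPhi' φ' a t := by
  have hm := shPhi'_mono_aux hN ha
  have hi : ∀ u v : ℝ, 0 ≤ u → 0 ≤ v → IntervalIntegrable (shPhi' φ' a) volume u v := by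
    intro u v hu hv
    apply MonotoneOn.intervalIntegrable
    exact hm.mono fun x hx => (le_min hu hv).trans hx.1
  have h0 : ∀ x, 0 ≤ x → 0 ≤ shPhi' φ' a x := fun x hx => by
    have := hm (a := 0) (b := x) self_mem_Ici hx hx
    simpa [shPhi'] using this
  have e : shPhi φ' a t = ∫ s in (0:ℝ)..t, shPhi' φ' a s := rfl
  rw [e]
  constructor
  · rw [← intervalIntegral.integral_add_adjacent_intervals
      (hi 0 (t/2) le_rfl (by linarith)) (hi (t/2) t (by linarith) ht)]
    have A : 0 ≤ ∫ s in (0:ℝ)..(t/2), shPhi' φ' a s :=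
      intervalIntegral.integral_nonneg (by linarith) fun u hu => h0 u hu.1
    have B : ∫ s in (t/2)..t, shPhi' φ' a (t/2) ≤ ∫ s in (t/2)..t, shPhi' φ' a s := by
      apply intervalIntegral.integral_mono_on (by linarith) (by simp)
        (hi (t/2) t (by linarith) ht)
      intro x hx
      exact hm (show 0 ≤ t/2 by linarith) (show 0 ≤ x by linarith [hx.1]) hx.1
    rw [intervalIntegral.integral_const, smul_eq_mul] at B
    have : t - t / 2 = t / 2 := by ring
    rw [this] at B
    linarith
  · have B : ∫ s in (0:ℝ)..t, shPhi' φ' a s ≤ ∫ s in (0:ℝ)..t, shPhi' φ' a t := by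
      apply intervalIntegral.integral_mono_on ht (hi 0 t le_rfl ht) (by simp)
      intro x hx
      exact hm hx.1 ht hx.2
    rw [intervalIntegral.integral_const, smul_eq_mul, sub_zero] at B
    exact B

/-- The scalar version. -/
lemma scalar_aux {φ φ' φ'' : ℝ → ℝ} {G : ℝ} (hN : IsNFunction φ φ') (hG : GoodPhi φ φ' φ'' G)
    {a b t : ℝ} (ha : 0 ≤ a) (hb : 0 ≤ b) (ht : 0 < t) (h1 : t ≤ a + b) (h2 : b ≤ a + t) :
    φ'' (a + b) * t ≤ 2 * G * 2 ^ G * shPhi' φ' a t ∧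
    shPhi' φ' a t ≤ 2 * G * 2 ^ G * (φ'' (a + b) * t) ∧
    shPhi' φ' a t ≤ 2 * 2 ^ G * shPhi' φ' a (t / 2) := by
  have hD := fun {t : ℝ} (ht : 0 < t) => doubling_aux hG (t := t) ht
  obtain ⟨-, hnn, hm, -, hpos, -, -⟩ := hN
  obtain ⟨hG1, -, -, -, -, hgb⟩ := hG
  have hK : (0:ℝ) < 2 ^ G := Real.rpow_pos_of_pos (by norm_num) _
  set K : ℝ := 2 ^ G
  have hG0 : 0 < G := by linarith
  have hs : 0 < a + t := by linarith
  have hM : 0 < a + b := by linarith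
  obtain ⟨g1, g2⟩ := hgb (a + b) hM
  have g1' : φ' (a + b) ≤ G * ((a + b) * φ'' (a + b)) := by
    rwa [inv_mul_le_iff₀ hG0] at g1
  have k1 : φ' (a + t) ≤ K * φ' (a + b) :=
    (hm _ (2 * (a + b)) hs.le (by linarith)).trans (hD hM)
  have k2 : φ' (a + b) ≤ K * φ' (a + t) :=
    (hm _ (2 * (a + t)) hM.le (by linarith)).trans (hD hs)
  have p1 := hpos _ hs
  have p2 := hpos _ hM
  have hf : 0 ≤ φ'' (a + b) := by
    by_contra hcon
    push Not at hcon
    nlinarith [mul_pos hM (neg_pos.2 hcon), mul_pos hG0 (mul_pos hM (neg_pos.2 hcon))]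
  unfold shPhi'
  refine ⟨?_, ?_, ?_⟩
  · have : φ'' (a + b) ≤ 2 * G * K * (φ' (a + t) / (a + t)) := by
      have q : (a + b) * φ'' (a + b) ≤ G * (K * φ' (a + t)) :=
        g2.trans (mul_le_mul_of_nonneg_left k2 hG0.le)
      rw [← mul_div_assoc, le_div_iff₀ hs]
      nlinarith [mul_nonneg hf hb, mul_nonneg hf ha]
    calc φ'' (a + b) * t ≤ 2 * G * K * (φ' (a + t) / (a + t)) * t :=
          mul_le_mul_of_nonneg_right this ht.le
      _ = _ := by ring
  · have : φ' (a + t) / (a + t) ≤ 2 * G * K * φ'' (a + b) := by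
      rw [div_le_iff₀ hs]
      have q : φ' (a + t) ≤ K * (G * ((a + b) * φ'' (a + b))) :=
        k1.trans (mul_le_mul_of_nonneg_left g1' hK.le)
      have r : (a + b) * (K * G * φ'' (a + b)) ≤ (2 * (a + t)) * (K * G * φ'' (a + b)) :=
        mul_le_mul_of_nonneg_right (by linarith) (by positivity)
      linarith
    calc φ' (a + t) * t / (a + t) = φ' (a + t) / (a + t) * t := by ring
      _ ≤ 2 * G * K * φ'' (a + b) * t := mul_le_mul_of_nonneg_right this ht.le
      _ = _ := by ring
  · have hs2 : 0 < a + t / 2 := by linarith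
    have k3 : φ' (a + t) ≤ K * φ' (a + t / 2) :=
      (hm _ (2 * (a + t / 2)) hs.le (by linarith)).trans (hD hs2)
    have p3 := hpos _ hs2
    calc φ' (a + t) * t / (a + t) ≤ (K * φ' (a + t / 2)) * t / (a + t) := by gcongr
      _ ≤ (K * φ' (a + t / 2)) * t / (a + t / 2) := by gcongr; linarith
      _ = _ := by ring

/-- Equivalences (53): `φ''(|S|+|T|)·|S−T| ∼ φ'_{|S|}(|S−T|)` and
`φ''(|S|+|T|)·|S−T|² ∼ φ_{|S|}(|S−T|)` with constants depending only on `G`. -/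
theorem shifted_equiv_second_derivative :
    ∃ c C : ℝ → ℝ, ∀ (G : ℝ) (d : ℕ) (φ φ' φ'' : ℝ → ℝ),
      IsNFunction φ φ' → GoodPhi φ φ' φ'' G →
      0 < c G ∧ 0 < C G ∧
      ∀ S T : Matrix (Fin d) (Fin d) ℝ, S.IsSymm → T.IsSymm →
        0 < fnorm S + fnorm T →
        (c G * (φ'' (fnorm S + fnorm T) * fnorm (S - T)) ≤
            shPhi' φ' (fnorm S) (fnorm (S - T)) ∧
          shPhi' φ' (fnorm S) (fnorm (S - T)) ≤
            C G * (φ'' (fnorm S + fnorm T) * fnorm (S - T))) ∧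
        (c G * (φ'' (fnorm S + fnorm T) * fnorm (S - T) ^ 2) ≤
            shPhi φ' (fnorm S) (fnorm (S - T)) ∧
          shPhi φ' (fnorm S) (fnorm (S - T)) ≤
            C G * (φ'' (fnorm S + fnorm T) * fnorm (S - T) ^ 2)) := by
  refine ⟨fun G => (8 * G * (2 ^ G) ^ 2)⁻¹, fun G => 2 * G * 2 ^ G, ?_⟩
  intro G d φ φ' φ'' hN hG
  have hG1 : 1 ≤ G := hG.1
  have hK1 : (1:ℝ) ≤ 2 ^ G := Real.one_le_rpow (by norm_num) (by linarith)
  refine ⟨by positivity, by positivity, ?_⟩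
  intro S T _ _ hpos
  obtain ⟨h1, h2⟩ := fnorm_tri_aux S T
  have ha := fnorm_nonneg_aux S
  have hb := fnorm_nonneg_aux T
  have ht := fnorm_nonneg_aux (S - T)
  generalize fnorm S = a at *
  generalize fnorm T = b at *
  generalize fnorm (S - T) = t at *
  rcases ht.eq_or_lt with rfl | ht0
  · simp [shPhi', shPhi]
  obtain ⟨s1, s2, s3⟩ := scalar_aux hN hG ha hb ht0 h1 h2
  obtain ⟨i1, i2⟩ := shPhi_bounds_aux hN ha ht
  beta_reduce
  generalize φ'' (a + b) = f at *
  generalize shPhi' φ' a (t / 2) = w at *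
  generalize shPhi φ' a t = I at *
  generalize shPhi' φ' a t = v at *
  generalize (2:ℝ) ^ G = K at *
  have hKG : 0 < 2 * G * K := by positivity
  have hv : 0 ≤ v := by
    have : v ≤ 2 * G * K * (2 * G * K * v) := s2.trans (mul_le_mul_of_nonneg_left s1 hKG.le)
    have h4 : 1 < 2 * G * K := by nlinarith
    by_contra hcon
    push Not at hcon
    nlinarith [mul_pos (neg_pos.2 hcon) (show 0 < (2 * G * K) * (2 * G * K) - 1 by nlinarith)]
  have hP : 0 < 8 * G * K ^ 2 := by positivity
  refine ⟨⟨?_, s2⟩, ?_, ?_⟩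
  · rw [inv_mul_le_iff₀ hP]
    refine s1.trans (mul_le_mul_of_nonneg_right ?_ hv)
    nlinarith [mul_le_mul_of_nonneg_left hK1 hKG.le]
  · rw [inv_mul_le_iff₀ hP]
    calc f * t ^ 2 = t * (f * t) := by ring
      _ ≤ t * (2 * G * K * (2 * K * w)) :=
        mul_le_mul_of_nonneg_left (s1.trans (mul_le_mul_of_nonneg_left s3 hKG.le)) ht
      _ = 8 * G * K ^ 2 * (t / 2 * w) := by ring
      _ ≤ _ := mul_le_mul_of_nonneg_left i1 hP.le
  · calc I ≤ t * v := i2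
      _ ≤ t * (2 * G * K * (f * t)) := mul_le_mul_of_nonneg_left s2 ht
      _ = _ := by ring
end
end
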